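/- Let D be a semilocal Prüfer domain with quotient field K and standard decomposition Θ; let Δ ≠ {K} be a subset of SkOver(D) containing K and closed under intersections. Then the map Γ_Δ : SStar_Δ(D) → ∏{hom(Δ(T), FStar(T)) : T ∈ Θ, Δ(T) ≠ ∅}, ⋆ ↦ (Γ_T(⋆))_{T∈Θ}, is an order isomorphism. -/

import Mathlib

/- Common background: Prüfer domains, semistar and (fractional) star operations,
standard decomposition, skeleton, supports, `hiSpec`, the rings `Z(P)`,
and the invariants `ω` and `ε`, following Spirito,
"Semistar operations on semilocal Prüfer domains". -/

set_option linter.unusedSectionVars false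
set_option maxHeartbeats 1000000

open Pointwise

noncomputable section

namespace Paper

variable (D : Type*) [CommRing D] [IsDomain D]
variable (K : Type*) [Field K] [Algebra D K] [IsFractionRing D K]

/-- The localization of `D` at a prime ideal `P`, viewed as an overring of `D`
inside its quotient field `K`. -/
def locAt (P : Ideal D) (hP : P.IsPrime) : Subalgebra D K :=
  Localization.subalgebra K (@Ideal.primeCompl D _ P hP)
    (fun _ hx => mem_nonZeroDivisors_of_ne_zero fun h => hx (h ▸ P.zero_mem))

/-- A Prüfer domain: every localization at a prime ideal is a valuation domain
(any two elements are comparable w.r.t. divisibility). -/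
def IsPrufer : Prop :=
  ∀ (P : Ideal D) (hP : P.IsPrime), ∀ x y : locAt D K P hP, ∃ z, x * z = y ∨ y * z = x

/-- A semilocal ring: finitely many maximal ideals. -/
def IsSemilocal : Prop := {I : Ideal D | I.IsMaximal}.Finite

/-- Two ideals are dependent if some nonzero prime ideal is contained in both. -/
def Dependent (M N : Ideal D) : Prop :=
  ∃ P : Ideal D, P.IsPrime ∧ P ≠ ⊥ ∧ P ≤ M ∧ P ≤ N

/-- The member of the standard decomposition corresponding to the dependence class
of the maximal ideal `M`: the intersection of the localizations of `D` at the
maximal ideals dependent on `M`. -/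
def TOf (M : Ideal D) : Subalgebra D K :=
  sInf {A | ∃ (N : Ideal D) (hN : N.IsMaximal), Dependent D M N ∧ A = locAt D K N hN.isPrime}

/-- The standard decomposition of `D`. -/
def stdDecomp : Set (Subalgebra D K) :=
  {T | ∃ M : Ideal D, M.IsMaximal ∧ T = TOf D K M}

/-- The skeleton of `Over(D)`: all intersections of subsets of the standard
decomposition (including the empty intersection `K` and the total one `D`). -/
def SkOver : Set (Subalgebra D K) :=
  {A | ∃ S ⊆ stdDecomp D K, A = sInf S}

/-- `I` is a fractional ideal of the overring `A` of `D`: it is an `A`-submodule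
of `K` and `dI ⊆ A` for some nonzero `d ∈ K`. -/
def IsFracOf (A : Subalgebra D K) (I : Submodule D K) : Prop :=
  (∀ a ∈ A, ∀ x ∈ I, a * x ∈ I) ∧ ∃ d : K, d ≠ 0 ∧ ∀ x ∈ I, d * x ∈ A

end Paper

namespace Paper

/-- A semistar operation on a domain `R` with quotient field `K`: an extensive,
order-preserving, idempotent self-map of the set of `R`-submodules of `K` such
that `(xI)^⋆ = x·I^⋆` for every nonzero `x ∈ K`. -/
structure Semistar (R : Type*) [CommRing R] (K : Type*) [Field K] [Algebra R K] where
  toFun : Submodule R K → Submodule R K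
  le_star' : ∀ I, I ≤ toFun I
  mono' : ∀ ⦃I J⦄, I ≤ J → toFun I ≤ toFun J
  idem' : ∀ I, toFun (toFun I) = toFun I
  smul' : ∀ (x : K), x ≠ 0 → ∀ I,
    toFun (Submodule.span R {x} * I) = Submodule.span R {x} * toFun I

namespace Semistar

variable {R : Type*} [CommRing R] {K : Type*} [Field K] [Algebra R K]

theorem ext' {s t : Semistar R K} (h : s.toFun = t.toFun) : s = t := by
  cases s; cases t; cases h; rfl

instance : PartialOrder (Semistar R K) where
  le s t := ∀ I, s.toFun I ≤ t.toFun I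
  le_refl _ _ := le_rfl
  le_trans _ _ _ hab hbc I := (hab I).trans (hbc I)
  le_antisymm _ _ h h' := ext' (funext fun I => le_antisymm (h I) (h' I))

end Semistar

/-- The identity semistar operation `d`. -/
def dOp (R : Type*) [CommRing R] (K : Type*) [Field K] [Algebra R K] : Semistar R K where
  toFun I := I
  le_star' _ := le_rfl
  mono' _ _ h := h
  idem' _ := rfl
  smul' _ _ _ := rfl

end Paper

namespace Paper

variable (D : Type*) [CommRing D] [IsDomain D]
variable (K : Type*) [Field K] [Algebra D K] [IsFractionRing D K]

/-- A fractional star operation on an overring `A` of `D` (inside `K`): a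
semistar-like closure operation defined on the fractional ideals of `A`.
In particular `FracStar D K ⊥` is the set of fractional star operations on `D`. -/
structure FracStar (A : Subalgebra D K) where
  toFun : {I : Submodule D K // IsFracOf D K A I} → {I : Submodule D K // IsFracOf D K A I}
  le_star' : ∀ I, I.1 ≤ (toFun I).1
  mono' : ∀ I J, I.1 ≤ J.1 → (toFun I).1 ≤ (toFun J).1
  idem' : ∀ I, toFun (toFun I) = toFun I
  smul' : ∀ (x : K), x ≠ 0 → ∀ I J, J.1 = Submodule.span D {x} * I.1 →
    (toFun J).1 = Submodule.span D {x} * (toFun I).1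

namespace FracStar

variable {D K} {A : Subalgebra D K}

theorem ext' {s t : FracStar D K A} (h : s.toFun = t.toFun) : s = t := by
  cases s; cases t; cases h; rfl

instance : PartialOrder (FracStar D K A) where
  le s t := ∀ I, (s.toFun I).1 ≤ (t.toFun I).1
  le_refl _ _ := le_rfl
  le_trans _ _ _ hab hbc I := (hab I).trans (hbc I)
  le_antisymm _ _ h h' := ext' (funext fun I => Subtype.ext (le_antisymm (h I) (h' I)))

end FracStar

/-- A fractional star operation on the overring `A` is a *star operation* if it
closes `A` itself. -/
def FracStar.IsStarOp {A : Subalgebra D K} (f : FracStar D K A) : Prop :=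
  ∀ h : IsFracOf D K A (Subalgebra.toSubmodule A),
    (f.toFun ⟨Subalgebra.toSubmodule A, h⟩).1 = Subalgebra.toSubmodule A

/-- The support of a semistar operation on `D`: the elements `A` of the skeleton
such that `A^⋆` is a fractional ideal of `A`. -/
def supp (s : Semistar D K) : Set (Subalgebra D K) :=
  {A | A ∈ SkOver D K ∧ IsFracOf D K A (s.toFun (Subalgebra.toSubmodule A))}

/-- The image of an ideal of `D` inside `K`. -/
def idealToK (P : Ideal D) : Submodule D K := Submodule.map (Algebra.linearMap D K) P

end Paper

namespace Paper

/-- An abstract fractional star operation on a commutative ring `A`, acting on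
the fractional ideals of `A` inside its fraction ring. -/
structure AFracStar (A : Type*) [CommRing A] where
  toFun : FractionalIdeal (nonZeroDivisors A) (FractionRing A) →
    FractionalIdeal (nonZeroDivisors A) (FractionRing A)
  le_star' : ∀ I, I ≤ toFun I
  mono' : ∀ ⦃I J⦄, I ≤ J → toFun I ≤ toFun J
  idem' : ∀ I, toFun (toFun I) = toFun I
  smul' : ∀ (x : FractionRing A), x ≠ 0 → ∀ I,
    toFun (FractionalIdeal.spanSingleton (nonZeroDivisors A) x * I) =
      FractionalIdeal.spanSingleton (nonZeroDivisors A) x * toFun I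

namespace AFracStar

variable {A : Type*} [CommRing A]

theorem ext' {s t : AFracStar A} (h : s.toFun = t.toFun) : s = t := by
  cases s; cases t; cases h; rfl

instance : PartialOrder (AFracStar A) where
  le s t := ∀ I, s.toFun I ≤ t.toFun I
  le_refl _ _ := le_rfl
  le_trans _ _ _ hab hbc I := (hab I).trans (hbc I)
  le_antisymm _ _ h h' := ext' (funext fun I => le_antisymm (h I) (h' I))

end AFracStar

/-- Abstract star operations on `A`: fractional star operations closing `A`. -/
def AStar (A : Type*) [CommRing A] : Type _ := {s : AFracStar A // s.toFun 1 = 1}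

instance (A : Type*) [CommRing A] : PartialOrder (AStar A) :=
  inferInstanceAs (PartialOrder {s : AFracStar A // s.toFun 1 = 1})

end Paper

namespace Paper

variable (D : Type*) [CommRing D] [IsDomain D]

/-- `P` is a branching point of `Spec(D)`: the infimum (among the primes) of a
family of pairwise incomparable primes not containing `P`. -/
def IsBranchPoint (P : Ideal D) : Prop :=
  ∃ S : Set (Ideal D), (∀ Q ∈ S, Q.IsPrime) ∧
    (S.Pairwise fun Q₁ Q₂ => ¬Q₁ ≤ Q₂ ∧ ¬Q₂ ≤ Q₁) ∧ P ∉ S ∧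
    (∀ Q ∈ S, P ≤ Q) ∧ ∀ P' : Ideal D, P'.IsPrime → (∀ Q ∈ S, P' ≤ Q) → P' ≤ P

/-- The homeomorphically irreducible tree underlying `Spec(D)`: the zero ideal,
the maximal ideals and the branching points, ordered by inclusion. -/
def hiSpec : Set (Ideal D) :=
  {P | P.IsPrime ∧ (P = ⊥ ∨ P.IsMaximal ∨ IsBranchPoint D P)}

/-- `Q` is the element of `hiSpec D` directly below `P`. -/
def DirectlyBelow (Q P : Ideal D) : Prop :=
  Q ∈ hiSpec D ∧ P ∈ hiSpec D ∧ Q < P ∧ ∀ R ∈ hiSpec D, Q < R → ¬R < P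

/-- The localization of `D` at the prime ideal `P`, as an abstract ring. -/
abbrev locRing (P : Ideal D) (hP : P.IsPrime) : Type _ :=
  Localization (@Ideal.primeCompl D _ P hP)

/-- The valuation ring `Z(P) = D_P / Q·D_P`. -/
abbrev Zring (P Q : Ideal D) (hP : P.IsPrime) : Type _ :=
  locRing D P hP ⧸ Ideal.map (algebraMap D (locRing D P hP)) Q

/-- `ω(P) = |FStar(Z(P))|`, where `Q` is the element of `hiSpec D` directly
below `P`. -/
def omegaAt (P Q : Ideal D) (hP : P.IsPrime) : ℕ :=
  Nat.card (AFracStar (Zring D P Q hP))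

open Classical in
/-- `ε(P) = |Star(D_P)| ∈ {1,2}` for a (nonzero) prime `P`. -/
def epsilonOf (A : Ideal D) : ℕ :=
  if h : A.IsPrime then Nat.card (AStar (locRing D A h)) else 0

end Paper

namespace Paper

theorem mem_hiSpec_prime {D : Type*} [CommRing D] [IsDomain D] {P : Ideal D}
    (h : P ∈ hiSpec D) : P.IsPrime := h.1

theorem maximal_mem_hiSpec {D : Type*} [CommRing D] [IsDomain D] {M : Ideal D}
    (h : M.IsMaximal) : M ∈ hiSpec D := ⟨h.isPrime, Or.inr (Or.inl h)⟩

end Paper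

namespace Paper

section Localizations

variable {D : Type*} [CommRing D] [IsDomain D]
variable {K : Type*} [Field K] [Algebra D K] [IsFractionRing D K]

theorem algebraMap_ne_zero {d : D} (hd : d ≠ 0) : algebraMap D K d ≠ 0 :=
  (map_ne_zero_iff _ (IsFractionRing.injective D K)).2 hd

theorem exists_eq_div (x : K) : ∃ a b : D, b ≠ 0 ∧ x = algebraMap D K a / algebraMap D K b := by
  obtain ⟨a, b, hb, h⟩ := IsFractionRing.div_surjective D x
  exact ⟨a, b, nonZeroDivisors.ne_zero hb, h.symm⟩

theorem mem_locAt {P : Ideal D} {hP : P.IsPrime} {x : K} :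
    x ∈ locAt D K P hP ↔ ∃ a s : D, s ∉ P ∧ x = algebraMap D K a / algebraMap D K s := by
  rw [locAt, ← Localization.subalgebra.ofField_eq]
  simp only [div_eq_mul_inv]
  exact ⟨fun ⟨a, s, hs, h⟩ => ⟨a, s, hs, h⟩, fun ⟨a, s, hs, h⟩ => ⟨a, s, hs, h⟩⟩

theorem div_mem_or_div_mem (hPruf : IsPrufer D K) {P : Ideal D} (hP : P.IsPrime) (x y : K) :
    y / x ∈ locAt D K P hP ∨ (y ≠ 0 ∧ x / y ∈ locAt D K P hP) := by
  rcases eq_or_ne x 0 with rfl | hx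
  · left; simp
  rcases eq_or_ne y 0 with rfl | hy
  · left; simp
  obtain ⟨a, b, hb, rfl⟩ := exists_eq_div (D := D) x
  obtain ⟨c, d, hd, rfl⟩ := exists_eq_div (D := D) y
  have hb' := algebraMap_ne_zero (K := K) hb
  have hd' := algebraMap_ne_zero (K := K) hd
  obtain ⟨⟨z, hz⟩, h⟩ := hPruf P hP ⟨algebraMap D K (a * d), Subalgebra.algebraMap_mem _ _⟩
    ⟨algebraMap D K (c * b), Subalgebra.algebraMap_mem _ _⟩
  have ha : algebraMap D K a ≠ 0 := fun h => hx (by simp [h])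
  have hc : algebraMap D K c ≠ 0 := fun h => hy (by simp [h])
  simp only [Subtype.ext_iff, MulMemClass.mk_mul_mk, map_mul] at h
  rcases h with h | h
  · left
    convert hz using 1
    field_simp
    rw [← h]; ring
  · right
    refine ⟨hy, ?_⟩
    convert hz using 1
    field_simp
    rw [← h]; ring

theorem le_or_le_of_le (hPruf : IsPrufer D K) {N P Q : Ideal D} (hN : N.IsPrime)
    (hP : P.IsPrime) (hQ : Q.IsPrime) (hPN : P ≤ N) (hQN : Q ≤ N) : P ≤ Q ∨ Q ≤ P := by
  have key : ∀ {P Q : Ideal D}, P.IsPrime → P ≤ N → ∀ p ∈ P, ∀ q ∉ P,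
      p ≠ 0 → algebraMap D K q / algebraMap D K p ∉ locAt D K N hN := by
    intro P Q hP hPN p hp q hq hp0 hmem
    obtain ⟨a, s, hs, h⟩ := mem_locAt.1 hmem
    have hs0 : s ≠ 0 := fun h => hs (h ▸ N.zero_mem)
    rw [div_eq_div_iff (algebraMap_ne_zero hp0) (algebraMap_ne_zero hs0), ← map_mul, ← map_mul]
      at h
    have h := IsFractionRing.injective D K h
    have : q * s ∈ P := h ▸ P.mul_mem_left a hp
    exact (hP.mem_or_mem this).elim hq fun h => hs (hPN h)
  by_contra! hcon
  obtain ⟨p, hpP, hpQ⟩ := Set.not_subset.1 hcon.1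
  obtain ⟨q, hqQ, hqP⟩ := Set.not_subset.1 hcon.2
  have hp0 : p ≠ 0 := fun h => hpQ (by simp [h])
  have hq0 : q ≠ 0 := fun h => hqP (by simp [h])
  rcases div_mem_or_div_mem hPruf hN (algebraMap D K p) (algebraMap D K q) with h | ⟨-, h⟩
  · exact key (Q := Q) hP hPN p hpP q hqP hp0 h
  · exact key (Q := P) hQ hQN q hqQ p hpQ hq0 h

theorem Dependent.symm {M N : Ideal D} (h : Dependent D M N) : Dependent D N M :=
  let ⟨P, hP, h0, hM, hN⟩ := h
  ⟨P, hP, h0, hN, hM⟩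

theorem Dependent.trans (hPruf : IsPrufer D K) {M N L : Ideal D} (hN : N.IsPrime)
    (h : Dependent D M N) (h' : Dependent D N L) : Dependent D M L := by
  obtain ⟨P, hP, hP0, hPM, hPN⟩ := h
  obtain ⟨Q, hQ, hQ0, hQN, hQL⟩ := h'
  rcases le_or_le_of_le hPruf hN hP hQ hPN hQN with hle | hle
  · exact ⟨P, hP, hP0, hPM, hle.trans hQL⟩
  · exact ⟨Q, hQ, hQ0, hle.trans hPM, hQL⟩

theorem TOf_eq_of_dependent (hPruf : IsPrufer D K) {M N : Ideal D} (hM : M.IsPrime)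
    (hN : N.IsPrime) (h : Dependent D M N) : TOf D K M = TOf D K N := by
  unfold TOf
  congr 1
  ext A
  constructor
  · rintro ⟨L, hL, hd, rfl⟩
    exact ⟨L, hL, h.symm.trans hPruf hM hd, rfl⟩
  · rintro ⟨L, hL, hd, rfl⟩
    exact ⟨L, hL, h.trans hPruf hN hd, rfl⟩

theorem mem_TOf {M : Ideal D} {x : K} : x ∈ TOf D K M ↔
    ∀ (N : Ideal D) (hN : N.IsMaximal), Dependent D M N → x ∈ locAt D K N hN.isPrime := by
  rw [TOf, Algebra.mem_sInf]
  exact ⟨fun h N hN hd => h _ ⟨N, hN, hd, rfl⟩, fun h A ⟨N, hN, hd, hA⟩ => hA ▸ h N hN hd⟩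

theorem exists_mul_mem_of_mem_mul {P : Ideal D} (hP : P.IsPrime) {T : Subalgebra D K}
    (hT : T ≤ locAt D K P hP) {I : Submodule D K} {x : K}
    (hx : x ∈ I * Subalgebra.toSubmodule T) : ∃ s : D, s ∉ P ∧ s • x ∈ I := by
  induction hx using Submodule.mul_induction_on' with
  | mem_mul_mem y hy t ht =>
    obtain ⟨a, s, hs, rfl⟩ := mem_locAt.1 (hT ht)
    refine ⟨s, hs, ?_⟩
    have hs0 : algebraMap D K s ≠ 0 := algebraMap_ne_zero fun h => hs (h ▸ P.zero_mem)
    have : s • (y * (algebraMap D K a / algebraMap D K s)) = a • y := by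
      simp only [Algebra.smul_def]; field_simp
    rw [this]
    exact I.smul_mem a hy
  | add x _ y _ hx hy =>
    obtain ⟨s, hs, hsx⟩ := hx
    obtain ⟨t, ht, hty⟩ := hy
    refine ⟨s * t, fun h => (hP.mem_or_mem h).elim hs ht, ?_⟩
    have : (s * t) • (x + y) = t • (s • x) + s • (t • y) := by
      rw [smul_add, mul_comm s t, mul_smul, mul_comm t s, mul_smul]
    rw [this]
    exact I.add_mem (I.smul_mem _ hsx) (I.smul_mem _ hty)

theorem mem_of_forall_mem_mul {I : Submodule D K} {x : K} (h0 : ∀ M : Ideal D, M.IsMaximal → M ≠ ⊥)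
    (hx : ∀ T ∈ stdDecomp D K, x ∈ I * Subalgebra.toSubmodule T) : x ∈ I := by
  let J : Ideal D := Submodule.comap (LinearMap.toSpanSingleton D K x) I
  by_cases hJ : J = ⊤
  · have : (1 : D) ∈ J := hJ ▸ Submodule.mem_top
    simpa [J] using this
  · obtain ⟨M, hM, hJM⟩ := Ideal.exists_le_maximal J hJ
    have hle : TOf D K M ≤ locAt D K M hM.isPrime := fun y hy =>
      mem_TOf.1 hy M hM ⟨M, hM.isPrime, h0 M hM, le_rfl, le_rfl⟩
    obtain ⟨s, hs, hsx⟩ := exists_mul_mem_of_mem_mul hM.isPrime hle (hx _ ⟨M, hM, rfl⟩)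
    exact (hs (hJM (by simpa [J] using hsx))).elim

theorem exists_notMem_of_not_dependent {M N : Ideal D} (hM : M.IsPrime) (hN : N.IsPrime)
    (h : ¬ Dependent D M N) {d : D} (hd : d ≠ 0) :
    ∃ m : D, m ∉ M ∧ algebraMap D K m / algebraMap D K d ∈ locAt D K N hN := by
  by_contra! hcon
  have hdis : Disjoint ((Ideal.span {d} : Ideal D) : Set D)
      ((M.primeCompl ⊔ N.primeCompl : Submonoid D) : Set D) := by
    refine Set.disjoint_left.2 fun x hx hx' => ?_
    obtain ⟨m, hm, n, hn, rfl⟩ := Submonoid.mem_sup.1 hx'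
    obtain ⟨c, hc⟩ := Ideal.mem_span_singleton.1 hx
    refine hcon m hm (mem_locAt.2 ⟨c, n, hn, ?_⟩)
    have hn0 : n ≠ 0 := fun h => hn (h ▸ N.zero_mem)
    rw [div_eq_div_iff (algebraMap_ne_zero hd) (algebraMap_ne_zero hn0), ← map_mul, hc,
      map_mul, mul_comm]
  obtain ⟨P, hP, hdP, hPdis⟩ := Ideal.exists_le_prime_disjoint _ _ hdis
  refine h ⟨P, hP, ?_, fun x hx => ?_, fun x hx => ?_⟩
  · rintro rfl
    exact hd ((Ideal.span_singleton_le_iff_mem _).1 hdP)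
  · by_contra hxM
    exact Set.disjoint_left.1 hPdis hx (Submonoid.mem_sup_left (show x ∈ M.primeCompl from hxM))
  · by_contra hxN
    exact Set.disjoint_left.1 hPdis hx (Submonoid.mem_sup_right (show x ∈ N.primeCompl from hxN))

theorem exists_inv_mem_TOf (hPruf : IsPrufer D K) (hsl : IsSemilocal D) {M : Ideal D}
    (hM : M.IsMaximal) (hM0 : M ≠ ⊥) {d : D} (hd : d ≠ 0) :
    ∃ s : D, s ≠ 0 ∧ (algebraMap D K s)⁻¹ ∈ TOf D K M ∧
      ∀ T ∈ stdDecomp D K, T ≠ TOf D K M → algebraMap D K s / algebraMap D K d ∈ T := by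
  classical
  let S : Set {N : Ideal D // N.IsMaximal} := {N | ¬ Dependent D M N.1}
  have : Finite {N : Ideal D // N.IsMaximal} := hsl.to_subtype
  let c : {N : Ideal D // N.IsMaximal} → Ideal D := fun N =>
    Submodule.comap (LinearMap.toSpanSingleton D K (algebraMap D K d)⁻¹)
      (Subalgebra.toSubmodule (locAt D K N.1 N.2.isPrime))
  have hc : ∀ N s, s ∈ c N ↔ algebraMap D K s / algebraMap D K d ∈ locAt D K N.1 N.2.isPrime := by
    intro N s
    simp [c, Algebra.smul_def, div_eq_mul_inv]
  let J : Ideal D := S.toFinite.toFinset.inf c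
  have hJ : ∀ L : Ideal D, L.IsMaximal → Dependent D M L → ¬ J ≤ L := by
    intro L hL hML hle
    obtain ⟨N, hN, hNL⟩ := (hL.isPrime.inf_le').1 hle
    have hN : ¬ Dependent D M N.1 := by simpa [S] using hN
    obtain ⟨m, hm, hmem⟩ := exists_notMem_of_not_dependent (K := K) hL.isPrime N.2.isPrime
      (fun h => hN (hML.trans hPruf hL.isPrime h)) hd
    exact hm (hNL ((hc _ _).2 hmem))
  have hfin : {L : Ideal D | L.IsMaximal ∧ Dependent D M L}.Finite := hsl.subset fun _ h => h.1
  have hav : ¬ ((J : Set D) ⊆ ⋃ L ∈ {L : Ideal D | L.IsMaximal ∧ Dependent D M L}, (L : Set D)) := by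
    intro h
    obtain ⟨L, hL, hle⟩ := (Ideal.subset_union_prime_finite hfin (f := fun L => L) ⊥ ⊥
      (fun L hL _ _ => hL.1.isPrime)).1 h
    exact hJ L hL.1 hL.2 hle
  obtain ⟨s, hsJ, hs⟩ := Set.not_subset.1 hav
  have hs : ∀ L : Ideal D, L.IsMaximal → Dependent D M L → s ∉ L := by simpa using hs
  have hs0 : s ≠ 0 := fun h =>
    hs M hM ⟨M, hM.isPrime, hM0, le_rfl, le_rfl⟩ (h ▸ M.zero_mem)
  refine ⟨s, hs0, mem_TOf.2 fun L hL hML => mem_locAt.2 ⟨1, s, hs L hL hML, by simp⟩, ?_⟩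
  rintro T ⟨N, hN, rfl⟩ hne
  refine mem_TOf.2 fun L hL hNL => ?_
  have hnd : (⟨L, hL⟩ : {N : Ideal D // N.IsMaximal}) ∈ S.toFinite.toFinset := by
    simp only [Set.Finite.mem_toFinset]
    intro hML
    exact hne (TOf_eq_of_dependent hPruf hN.isPrime hM.isPrime
      (hNL.trans hPruf hL.isPrime hML.symm))
  exact (hc ⟨L, hL⟩ s).1 ((Finset.inf_le hnd : J ≤ c ⟨L, hL⟩) hsJ)

theorem exists_prime_le_of_dependent (hPruf : IsPrufer D K) (hsl : IsSemilocal D) {M : Ideal D}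
    (hM : M.IsMaximal) (hM0 : M ≠ ⊥) : ∃ P : Ideal D, P.IsPrime ∧ P ≠ ⊥ ∧
      ∀ N : Ideal D, N.IsMaximal → Dependent D M N → P ≤ N := by
  have hfin : {L : Ideal D | L.IsMaximal ∧ Dependent D M L}.Finite := hsl.subset fun _ h => h.1
  have : ∀ N : {L : Ideal D | L.IsMaximal ∧ Dependent D M L}, Dependent D M N.1 := fun N => N.2.2
  choose f hf hf0 hfM hfN using this
  have hMM : Dependent D M M := ⟨M, hM.isPrime, hM0, le_rfl, le_rfl⟩
  have := hfin.to_subtype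
  obtain ⟨P, ⟨L, rfl⟩, hmin⟩ := (Set.finite_range f).exists_minimal ⟨_, ⟨M, hM, hMM⟩, rfl⟩
  refine ⟨f L, hf L, hf0 L, fun N hN hMN => ?_⟩
  have hle : f L ≤ f ⟨N, hN, hMN⟩ :=
    (le_or_le_of_le hPruf hM.isPrime (hf L) (hf ⟨N, hN, hMN⟩) (hfM L) (hfM _)).elim id
      fun h => hmin ⟨_, rfl⟩ h
  exact hle.trans (hfN ⟨N, hN, hMN⟩)

theorem mul_TOf_eq_top_or (hPruf : IsPrufer D K) (hsl : IsSemilocal D) {M : Ideal D}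
    (hM : M.IsMaximal) (hM0 : M ≠ ⊥) (I : Submodule D K) :
    I * Subalgebra.toSubmodule (TOf D K M) = ⊤ ∨
      ∃ d : K, d ≠ 0 ∧ ∀ x ∈ I, d * x ∈ TOf D K M := by
  obtain ⟨P, hP, hP0, hPN⟩ := exists_prime_le_of_dependent hPruf hsl hM hM0
  obtain ⟨p, hp, hp0⟩ := Submodule.exists_mem_ne_zero_of_ne_bot hP0
  have hp0' := algebraMap_ne_zero (K := K) hp0
  have hdiv : ∀ q ∈ P, ∀ s ∉ P, algebraMap D K q / algebraMap D K s ∈ TOf D K M := by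
    intro q hq s hs
    have hs0 : s ≠ 0 := fun h => hs (h ▸ P.zero_mem)
    refine mem_TOf.2 fun N hN hMN => ?_
    rcases div_mem_or_div_mem hPruf hN.isPrime (algebraMap D K s) (algebraMap D K q)
      with h | ⟨hq0, h⟩
    · exact h
    · obtain ⟨a, t, ht, h⟩ := mem_locAt.1 h
      have ht0 : t ≠ 0 := fun h => ht (h ▸ N.zero_mem)
      rw [div_eq_div_iff hq0 (algebraMap_ne_zero ht0), ← map_mul, ← map_mul] at h
      have h := IsFractionRing.injective D K h
      have : s * t ∈ P := h ▸ P.mul_mem_left a hq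
      exact ((hP.mem_or_mem this).elim hs fun h => ht (hPN N hN hMN h)).elim
  by_cases hI : ∀ x : K, ∃ s : D, s ∉ P ∧ s • x ∈ I
  · left
    refine eq_top_iff.2 fun x _ => ?_
    obtain ⟨s, hs, hsx⟩ := hI (x / algebraMap D K p)
    have hs0 : algebraMap D K s ≠ 0 := algebraMap_ne_zero fun h => hs (h ▸ P.zero_mem)
    have hps : algebraMap D K p / algebraMap D K s ∈ Subalgebra.toSubmodule (TOf D K M) :=
      hdiv p hp s hs
    convert Submodule.mul_mem_mul hsx hps using 1
    rw [Algebra.smul_def]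
    field_simp
  · right
    push Not at hI
    obtain ⟨x, hx⟩ := hI
    have hx0 : x ≠ 0 := fun h => hx 1 (hP.one_notMem) (by simp [h])
    refine ⟨algebraMap D K p / x, div_ne_zero hp0' hx0, fun y hy => ?_⟩
    have hmem : y / x ∈ locAt D K P hP := by
      rcases div_mem_or_div_mem hPruf hP x y with h | ⟨hy0, h⟩
      · exact h
      · obtain ⟨a, s, hs, h⟩ := mem_locAt.1 h
        have hs0 : algebraMap D K s ≠ 0 := algebraMap_ne_zero fun h => hs (h ▸ P.zero_mem)
        rw [div_eq_div_iff hy0 hs0] at h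
        refine (hx s hs ?_).elim
        rw [Algebra.smul_def, mul_comm, h, ← Algebra.smul_def]
        exact I.smul_mem a hy
    obtain ⟨a, s, hs, h⟩ := mem_locAt.1 hmem
    have : algebraMap D K p / x * y = algebraMap D K (a * p) / algebraMap D K s := by
      rw [div_mul_eq_mul_div, mul_div_assoc, h, map_mul]; ring
    rw [this]
    exact hdiv _ (P.mul_mem_left a hp) s hs

theorem TOf_ne_top {M : Ideal D} (hM : M.IsMaximal) (hM0 : M ≠ ⊥) : TOf D K M ≠ ⊤ := by
  intro h
  obtain ⟨p, hp, hp0⟩ := Submodule.exists_mem_ne_zero_of_ne_bot hM0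
  have : (algebraMap D K p)⁻¹ ∈ TOf D K M := h ▸ Algebra.mem_top
  obtain ⟨a, s, hs, h⟩ := mem_locAt.1
    (mem_TOf.1 this M hM ⟨M, hM.isPrime, hM0, le_rfl, le_rfl⟩)
  have hs0 : s ≠ 0 := fun h => hs (h ▸ M.zero_mem)
  rw [inv_eq_one_div, div_eq_div_iff (algebraMap_ne_zero hp0) (algebraMap_ne_zero hs0), one_mul,
    ← map_mul] at h
  exact hs (IsFractionRing.injective D K h ▸ M.mul_mem_left a hp)

end Localizations

section Decomposition

variable (D : Type*) [CommRing D] [IsDomain D]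
variable (K : Type*) [Field K] [Algebra D K] [IsFractionRing D K]

/-- The properties of the standard decomposition used to glue star operations: it is a finite
independent family of proper overrings detecting membership in `D`-submodules of `K`, and every
`D`-submodule extends to `K` or to a fractional ideal over each of its members. -/
structure IsIndependentDecomp : Prop where
  finite : (stdDecomp D K).Finite
  ne_top : ∀ T ∈ stdDecomp D K, T ≠ ⊤
  mem_of_forall : ∀ (I : Submodule D K) (x : K),
    (∀ T ∈ stdDecomp D K, x ∈ I * Subalgebra.toSubmodule T) → x ∈ I
  exists_inv_mem : ∀ T ∈ stdDecomp D K, ∀ d : D, d ≠ 0 → ∃ s : D, s ≠ 0 ∧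
    (algebraMap D K s)⁻¹ ∈ T ∧
      ∀ T' ∈ stdDecomp D K, T' ≠ T → algebraMap D K s / algebraMap D K d ∈ T'
  eq_top_or : ∀ T ∈ stdDecomp D K, ∀ I : Submodule D K, I * Subalgebra.toSubmodule T = ⊤ ∨
    ∃ d : D, d ≠ 0 ∧ ∀ x ∈ I, algebraMap D K d * x ∈ T

variable {D K}

theorem exists_denominator {T : Subalgebra D K} {I : Submodule D K}
    (h : ∃ d : K, d ≠ 0 ∧ ∀ x ∈ I, d * x ∈ T) :
    ∃ d : D, d ≠ 0 ∧ ∀ x ∈ I, algebraMap D K d * x ∈ T := by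
  obtain ⟨d, hd, h⟩ := h
  obtain ⟨a, b, hb, rfl⟩ := exists_eq_div (D := D) d
  have hb' := algebraMap_ne_zero (K := K) hb
  refine ⟨a, fun ha => hd (by simp [ha]), fun x hx => ?_⟩
  convert T.smul_mem (h x hx) b using 1
  rw [Algebra.smul_def]
  field_simp

theorem isIndependentDecomp (hPruf : IsPrufer D K) (hsl : IsSemilocal D)
    (h0 : ∀ M : Ideal D, M.IsMaximal → M ≠ ⊥) : IsIndependentDecomp D K where
  finite := (hsl.image (TOf D K)).subset fun _ ⟨M, hM, hT⟩ => ⟨M, hM, hT.symm⟩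
  ne_top := by
    rintro T ⟨M, hM, rfl⟩
    exact TOf_ne_top hM (h0 M hM)
  mem_of_forall _ _ := mem_of_forall_mem_mul h0
  exists_inv_mem := by
    rintro T ⟨M, hM, rfl⟩ d hd
    exact exists_inv_mem_TOf hPruf hsl hM (h0 M hM) hd
  eq_top_or := by
    rintro T ⟨M, hM, rfl⟩ I
    exact (mul_TOf_eq_top_or hPruf hsl hM (h0 M hM) I).imp_right exists_denominator

theorem ne_bot_of_skeleton_ne_top {A : Subalgebra D K} (hA : A ∈ SkOver D K) (hne : A ≠ ⊤)
    {M : Ideal D} (hM : M.IsMaximal) : M ≠ ⊥ := by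
  rintro rfl
  obtain ⟨S, hS, rfl⟩ := hA
  refine hne (eq_top_iff.2 (le_sInf fun T hT => ?_))
  obtain ⟨N, hN, rfl⟩ := hS hT
  refine le_sInf ?_
  rintro A ⟨L, hL, ⟨P, hP, hP0, hPN, -⟩, rfl⟩
  exact (hP0 (le_bot_iff.1 (hPN.trans (hM.eq_of_le hN.ne_top bot_le).ge))).elim

end Decomposition

section Localization

variable {D : Type*} [CommRing D] [IsDomain D]
variable {K : Type*} [Field K] [Algebra D K] [IsFractionRing D K]

theorem le_mul_toSubmodule (I : Submodule D K) (T : Subalgebra D K) :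
    I ≤ I * Subalgebra.toSubmodule T := fun x hx => by
  have h1 : (1 : K) ∈ Subalgebra.toSubmodule T := T.one_mem
  simpa using Submodule.mul_mem_mul hx h1

theorem mul_toSubmodule_mem {I : Submodule D K} {T : Subalgebra D K} {t x : K} (ht : t ∈ T)
    (hx : x ∈ I * Subalgebra.toSubmodule T) : t * x ∈ I * Subalgebra.toSubmodule T := by
  induction hx using Submodule.mul_induction_on' with
  | mem_mul_mem y hy u hu =>
    have htu : t * u ∈ Subalgebra.toSubmodule T := T.mul_mem ht hu
    convert Submodule.mul_mem_mul hy htu using 1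
    ring
  | add x _ y _ hx hy => rw [mul_add]; exact Submodule.add_mem _ hx hy

theorem mul_toSubmodule_le {I L : Submodule D K} {T : Subalgebra D K} (hIL : I ≤ L)
    (hL : ∀ t ∈ T, ∀ x ∈ L, t * x ∈ L) : I * Subalgebra.toSubmodule T ≤ L :=
  Submodule.mul_le.2 fun x hx t ht => mul_comm t x ▸ hL t ht x (hIL hx)

theorem mul_toSubmodule_mul_toSubmodule (I : Submodule D K) {A T : Subalgebra D K} (h : A ≤ T) :
    I * Subalgebra.toSubmodule A * Subalgebra.toSubmodule T = I * Subalgebra.toSubmodule T := by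
  refine le_antisymm (mul_toSubmodule_le ?_ fun t ht x hx => mul_toSubmodule_mem ht hx)
    (mul_le_mul_left (le_mul_toSubmodule I A) _)
  exact mul_le_mul_right (fun x hx => h hx) _

theorem mul_mem_mul_toSubmodule {I J : Submodule D K} {T : Subalgebra D K} {c : K}
    (h : ∀ z ∈ I, c * z ∈ J) {x : K} (hx : x ∈ I * Subalgebra.toSubmodule T) :
    c * x ∈ J * Subalgebra.toSubmodule T := by
  induction hx using Submodule.mul_induction_on' with
  | mem_mul_mem y hy u hu => rw [← mul_assoc]; exact Submodule.mul_mem_mul (h y hy) hu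
  | add x _ y _ hx hy => rw [mul_add]; exact Submodule.add_mem _ hx hy

theorem Semistar.mul_mem (s : Semistar D K) {c : K} {I J : Submodule D K}
    (h : ∀ z ∈ I, c * z ∈ J) {x : K} (hx : x ∈ s.toFun I) : c * x ∈ s.toFun J := by
  rcases eq_or_ne c 0 with rfl | hc
  · simp
  have hle : Submodule.span D {c} * I ≤ J := fun z hz => by
    obtain ⟨y, hy, rfl⟩ := Submodule.mem_span_singleton_mul.1 hz
    exact h y hy
  refine s.mono' hle ?_
  rw [s.smul' c hc]
  exact Submodule.mem_span_singleton_mul.2 ⟨x, hx, rfl⟩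

theorem IsFracOf.bot (A : Subalgebra D K) : IsFracOf D K A ⊥ :=
  ⟨by simp, 1, one_ne_zero, by simp⟩

theorem IsFracOf.toSubmodule (A : Subalgebra D K) : IsFracOf D K A (Subalgebra.toSubmodule A) :=
  ⟨fun _ ha _ hx => A.mul_mem ha hx, 1, one_ne_zero, fun x hx => by simpa using hx⟩

theorem IsFracOf.span_mul {A : Subalgebra D K} {I : Submodule D K} (hI : IsFracOf D K A I)
    {c : K} (hc : c ≠ 0) : IsFracOf D K A (Submodule.span D {c} * I) := by
  obtain ⟨hm, d, hd, h⟩ := hI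
  simp only [IsFracOf, Submodule.mem_span_singleton_mul]
  refine ⟨?_, d / c, div_ne_zero hd hc, ?_⟩
  · rintro a ha _ ⟨z, hz, rfl⟩
    exact ⟨a * z, hm a ha z hz, by ring⟩
  · rintro _ ⟨z, hz, rfl⟩
    convert h z hz using 1
    field_simp

theorem Semistar.isFracOf (s : Semistar D K) {A : Subalgebra D K} {I : Submodule D K}
    (hA : IsFracOf D K A (s.toFun (Subalgebra.toSubmodule A))) (hI : IsFracOf D K A I) :
    IsFracOf D K A (s.toFun I) := by
  obtain ⟨hm, d, hd, h⟩ := hI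
  obtain ⟨-, e, he, h'⟩ := hA
  refine ⟨fun a ha x hx => s.mul_mem (fun z hz => hm a ha z hz) hx, e * d, mul_ne_zero he hd,
    fun x hx => ?_⟩
  rw [mul_assoc]
  exact h' _ (s.mul_mem (fun z hz => h z hz) hx)

theorem FracStar.mul_mem {A : Subalgebra D K} (f : FracStar D K A) {c : K} (hc : c ≠ 0)
    {I J : Submodule D K} (hI : IsFracOf D K A I) (hJ : IsFracOf D K A J)
    (h : ∀ z ∈ I, c * z ∈ J) {x : K} (hx : x ∈ (f.toFun ⟨I, hI⟩).1) :
    c * x ∈ (f.toFun ⟨J, hJ⟩).1 := by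
  have hle : Submodule.span D {c} * I ≤ J := fun z hz => by
    obtain ⟨y, hy, rfl⟩ := Submodule.mem_span_singleton_mul.1 hz
    exact h y hy
  refine f.mono' ⟨_, hI.span_mul hc⟩ ⟨J, hJ⟩ hle ?_
  rw [f.smul' c hc ⟨I, hI⟩ ⟨_, hI.span_mul hc⟩ rfl]
  exact Submodule.mem_span_singleton_mul.2 ⟨x, hx, rfl⟩

theorem eq_top_of_forall_mul_mem {A : Subalgebra D K} {d : K} (hd : d ≠ 0)
    (h : ∀ x : K, d * x ∈ A) : A = ⊤ :=
  eq_top_iff.2 fun x _ => by simpa [hd] using h (d⁻¹ * x)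

theorem FracStar.toFun_bot {A : Subalgebra D K} (hA : A ≠ ⊤) (f : FracStar D K A)
    (h : IsFracOf D K A ⊥) : (f.toFun ⟨⊥, h⟩).1 = ⊥ := by
  by_contra hne
  obtain ⟨y, hy, hy0⟩ := Submodule.exists_mem_ne_zero_of_ne_bot hne
  obtain ⟨-, d, hd, hdA⟩ := (f.toFun ⟨⊥, h⟩).2
  refine hA (eq_top_of_forall_mul_mem (mul_ne_zero hd hy0) fun x => ?_)
  rcases eq_or_ne x 0 with rfl | hx
  · simp
  · have := hdA _ (f.mul_mem hx h h (by simp) hy)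
    convert this using 1
    ring

theorem Semistar.toFun_bot (s : Semistar D K) {A : Subalgebra D K} (hA : A ≠ ⊤)
    (hs : A ∈ supp D K s) : s.toFun ⊥ = ⊥ := by
  by_contra hne
  obtain ⟨y, hy, hy0⟩ := Submodule.exists_mem_ne_zero_of_ne_bot hne
  obtain ⟨-, d, hd, hdA⟩ := hs.2
  refine hA (eq_top_of_forall_mul_mem (mul_ne_zero hd hy0) fun x => ?_)
  have := hdA _ (s.mono' bot_le (s.mul_mem (c := x) (J := ⊥) (by simp) hy))
  convert this using 1
  ring

theorem mem_of_mem_skeleton {A : Subalgebra D K} (hA : A ∈ SkOver D K) {x : K}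
    (hx : ∀ T ∈ stdDecomp D K, A ≤ T → x ∈ T) : x ∈ A := by
  obtain ⟨S, hS, rfl⟩ := hA
  exact Algebra.mem_sInf.2 fun T hT => hx T (hS hT) (sInf_le hT)

theorem skeleton_le {A B : Subalgebra D K} (hA : A ∈ SkOver D K)
    (h : ∀ T ∈ stdDecomp D K, A ≤ T → B ≤ T) : B ≤ A :=
  fun _ hx => mem_of_mem_skeleton hA fun T hT hAT => h T hT hAT hx

theorem exists_le_of_skeleton_ne_top {A : Subalgebra D K} (hA : A ∈ SkOver D K) (hne : A ≠ ⊤) :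
    ∃ T ∈ stdDecomp D K, A ≤ T := by
  by_contra! hcon
  exact hne (eq_top_iff.2 (skeleton_le hA fun T hT hAT => (hcon T hT hAT).elim))

theorem mul_toSubmodule_ne_top {T : Subalgebra D K} (hT : T ≠ ⊤) {I : Submodule D K} {d : K}
    (hd : d ≠ 0) (h : ∀ x ∈ I, d * x ∈ T) : I * Subalgebra.toSubmodule T ≠ ⊤ := by
  intro htop
  refine hT (eq_top_of_forall_mul_mem hd fun x => ?_)
  have hx : x ∈ I * Subalgebra.toSubmodule T := htop ▸ Submodule.mem_top
  have hmem := mul_mem_mul_toSubmodule (J := Subalgebra.toSubmodule T) h hx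
  exact mul_toSubmodule_le le_rfl (fun t ht x hx => T.mul_mem ht hx) hmem

theorem IsFracOf.mul_ne_top {A T : Subalgebra D K} (hT : T ≠ ⊤) (hAT : A ≤ T)
    {I : Submodule D K} (hI : IsFracOf D K A I) : I * Subalgebra.toSubmodule T ≠ ⊤ := by
  obtain ⟨-, d, hd, h⟩ := hI
  exact mul_toSubmodule_ne_top hT hd fun x hx => hAT (h x hx)

namespace IsIndependentDecomp

variable (h : IsIndependentDecomp D K)
include h

theorem isFracOf_mul {T : Subalgebra D K} (hT : T ∈ stdDecomp D K) {I : Submodule D K}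
    (hI : I * Subalgebra.toSubmodule T ≠ ⊤) : IsFracOf D K T (I * Subalgebra.toSubmodule T) := by
  obtain ⟨d, hd, hdI⟩ := (h.eq_top_or T hT I).resolve_left hI
  refine ⟨fun t ht x hx => mul_toSubmodule_mem ht hx, algebraMap D K d,
    algebraMap_ne_zero hd, fun x hx => ?_⟩
  exact mul_toSubmodule_le le_rfl (fun t ht x hx => T.mul_mem ht hx)
    (mul_mem_mul_toSubmodule (J := Subalgebra.toSubmodule T) hdI hx)

theorem exists_inv_mem_of_not_le {A T : Subalgebra D K} (hA : A ∈ SkOver D K)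
    (hT : T ∈ stdDecomp D K) (hAT : ¬ A ≤ T) {d : D} (hd : d ≠ 0) :
    ∃ s : D, s ≠ 0 ∧ (algebraMap D K s)⁻¹ ∈ T ∧ algebraMap D K s / algebraMap D K d ∈ A := by
  obtain ⟨s, hs, hsT, hs'⟩ := h.exists_inv_mem T hT d hd
  refine ⟨s, hs, hsT, mem_of_mem_skeleton hA fun T' hT' hAT' => hs' T' hT' ?_⟩
  rintro rfl
  exact hAT hAT'

theorem mul_eq_top {A T : Subalgebra D K} (hA : A ∈ SkOver D K) (hT : T ∈ stdDecomp D K)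
    (hAT : ¬ A ≤ T) {I : Submodule D K} {x : K} (hx : x ≠ 0) (hI : ∀ a ∈ A, a * x ∈ I) :
    I * Subalgebra.toSubmodule T = ⊤ := by
  refine eq_top_iff.2 fun y _ => ?_
  obtain ⟨a, b, hb, hab⟩ := exists_eq_div (D := D) (y / x)
  obtain ⟨s, hs, hsT, hsA⟩ := h.exists_inv_mem_of_not_le hA hT hAT hb
  have hmem : (algebraMap D K s)⁻¹ * algebraMap D K a ∈ Subalgebra.toSubmodule T :=
    T.mul_mem hsT (T.algebraMap_mem a)
  convert Submodule.mul_mem_mul (hI _ hsA) hmem using 1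
  have hs' := algebraMap_ne_zero (K := K) hs
  have hb' := algebraMap_ne_zero (K := K) hb
  rw [div_eq_div_iff hx hb'] at hab
  field_simp
  rw [hab]; ring

theorem le_of_mul_ne_top {A T : Subalgebra D K} (hA : A ∈ SkOver D K) (hT : T ∈ stdDecomp D K)
    {I : Submodule D K} (hI : ∀ a ∈ A, ∀ x ∈ I, a * x ∈ I) (hI0 : I ≠ ⊥)
    (hne : I * Subalgebra.toSubmodule T ≠ ⊤) : A ≤ T := by
  obtain ⟨x, hx, hx0⟩ := Submodule.exists_mem_ne_zero_of_ne_bot hI0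
  by_contra hAT
  exact hne (h.mul_eq_top hA hT hAT hx0 fun a ha => hI a ha x hx)

theorem le_or_le_of_inf_le {A B T : Subalgebra D K} (hA : A ∈ SkOver D K) (hB : B ∈ SkOver D K)
    (hT : T ∈ stdDecomp D K) (hABT : A ⊓ B ≤ T) : A ≤ T ∨ B ≤ T := by
  by_contra! hcon
  refine h.ne_top T hT (eq_top_iff.2 fun x _ => ?_)
  obtain ⟨a, b, hb, rfl⟩ := exists_eq_div (D := D) x
  obtain ⟨s, hs, hsT, hs'⟩ := h.exists_inv_mem T hT b hb
  have hmem : algebraMap D K s / algebraMap D K b ∈ T := by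
    refine hABT (Algebra.mem_inf.2 ⟨mem_of_mem_skeleton hA fun T' hT' hle => hs' T' hT' ?_,
      mem_of_mem_skeleton hB fun T' hT' hle => hs' T' hT' ?_⟩)
    · rintro rfl; exact hcon.1 hle
    · rintro rfl; exact hcon.2 hle
  convert T.mul_mem (T.mul_mem hmem hsT) (T.algebraMap_mem a) using 1
  have hs' := algebraMap_ne_zero (K := K) hs
  field_simp

theorem exists_denominator_sInf {S : Set (Subalgebra D K)} (hS : S ⊆ stdDecomp D K)
    {I : Submodule D K} (hI : ∀ T ∈ S, I * Subalgebra.toSubmodule T ≠ ⊤) :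
    ∃ d : K, d ≠ 0 ∧ ∀ x ∈ I, d * x ∈ sInf S := by
  have : ∀ T : Subalgebra D K, ∃ d : D, d ≠ 0 ∧ (T ∈ S → ∀ x ∈ I, algebraMap D K d * x ∈ T) := by
    intro T
    by_cases hT : T ∈ S
    · obtain ⟨d, hd, hdI⟩ := (h.eq_top_or T (hS hT) I).resolve_left (hI T hT)
      exact ⟨d, hd, fun _ => hdI⟩
    · exact ⟨1, one_ne_zero, fun h => (hT h).elim⟩
  choose d hd hdI using this
  refine ⟨algebraMap D K (∏ T ∈ h.finite.toFinset, d T),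
    algebraMap_ne_zero (Finset.prod_ne_zero_iff.2 fun T _ => hd T), fun x hx =>
    Algebra.mem_sInf.2 fun T hT => ?_⟩
  obtain ⟨c, hc⟩ := Finset.dvd_prod_of_mem d (h.finite.mem_toFinset.2 (hS hT))
  rw [hc, mul_comm (d T), map_mul, mul_assoc]
  exact T.mul_mem (T.algebraMap_mem c) (hdI T hT x hx)

theorem exists_denominator_skeleton {A : Subalgebra D K} (hA : A ∈ SkOver D K)
    {I : Submodule D K}
    (hI : ∀ T ∈ stdDecomp D K, A ≤ T → I * Subalgebra.toSubmodule T ≠ ⊤) :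
    ∃ d : K, d ≠ 0 ∧ ∀ x ∈ I, d * x ∈ A := by
  obtain ⟨S, hS, rfl⟩ := hA
  exact h.exists_denominator_sInf hS fun T hT => hI T (hS hT) (sInf_le hT)

theorem star_le_star_mul (s : Semistar D K) {A T : Subalgebra D K} (hT : T ∈ stdDecomp D K)
    {I J : Submodule D K} (hI : IsFracOf D K A I) (hJ : IsFracOf D K A J)
    (hIJ : I ≤ J * Subalgebra.toSubmodule T) :
    s.toFun I ≤ s.toFun J * Subalgebra.toSubmodule T := by
  rcases eq_or_ne J ⊥ with rfl | hJ0
  · rw [Submodule.bot_mul, le_bot_iff] at hIJ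
    rw [hIJ]
    exact le_mul_toSubmodule _ _
  obtain ⟨x, hx, hx0⟩ := Submodule.exists_mem_ne_zero_of_ne_bot hJ0
  obtain ⟨-, e, he, heI⟩ := hI
  obtain ⟨a, b, hb, hab⟩ := exists_eq_div (D := D) (x * e)
  have hb' := algebraMap_ne_zero (K := K) hb
  have ha : a ≠ 0 := by
    rintro rfl
    simp [hx0, he] at hab
  have ha' := algebraMap_ne_zero (K := K) ha
  have haI : ∀ y ∈ I, algebraMap D K a * y ∈ J := by
    intro y hy
    have : algebraMap D K a * y = b • ((e * y) * x) := by
      rw [eq_div_iff hb'] at hab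
      rw [← hab, Algebra.smul_def]; ring
    rw [this]
    exact J.smul_mem b (hJ.1 _ (heI y hy) x hx)
  obtain ⟨c, hc, hcT, hc'⟩ := h.exists_inv_mem T hT a ha
  have hcI : ∀ y ∈ I, algebraMap D K c * y ∈ J := by
    intro y hy
    refine h.mem_of_forall J _ fun T' hT' => ?_
    rcases eq_or_ne T' T with rfl | hne
    · exact mul_toSubmodule_mem (T'.algebraMap_mem c) (hIJ hy)
    · convert mul_toSubmodule_mem (hc' T' hT' hne) (le_mul_toSubmodule J T' (haI y hy)) using 1
      field_simp
  intro y hy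
  have := mul_toSubmodule_mem hcT (le_mul_toSubmodule _ T (s.mul_mem hcI hy))
  rwa [inv_mul_cancel_left₀ (algebraMap_ne_zero hc)] at this

end IsIndependentDecomp

/-- The contraction of a submodule `L` over a member `T` of the standard decomposition to an
element `A ≤ T` of the skeleton: it agrees with `L` at `T` and with `A` at the other members. -/
def contraction (A T : Subalgebra D K) (L : Submodule D K) : Submodule D K :=
  L ⊓ Subalgebra.toSubmodule (sInf {T' | T' ∈ stdDecomp D K ∧ A ≤ T' ∧ T' ≠ T})

theorem mem_contraction {A T : Subalgebra D K} {L : Submodule D K} {x : K} :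
    x ∈ contraction A T L ↔ x ∈ L ∧ ∀ T' ∈ stdDecomp D K, A ≤ T' → T' ≠ T → x ∈ T' := by
  simp only [contraction, Submodule.mem_inf, Subalgebra.mem_toSubmodule, Algebra.mem_sInf,
    Set.mem_ofPred_eq, and_imp]

theorem contraction_mono {A B T : Subalgebra D K} {L L' : Submodule D K} (hAB : A ≤ B)
    (hL : L ≤ L') : contraction A T L ≤ contraction B T L' := fun _ hx =>
  have hx := mem_contraction.1 hx
  mem_contraction.2 ⟨hL hx.1, fun T' hT' hB => hx.2 T' hT' (hAB.trans hB)⟩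

theorem contraction_isFracOf {A T : Subalgebra D K} (hA : A ∈ SkOver D K) (hAT : A ≤ T)
    {L : Submodule D K} (hL : IsFracOf D K T L) : IsFracOf D K A (contraction A T L) := by
  obtain ⟨d, hd, hdL⟩ := exists_denominator hL.2
  refine ⟨fun a ha x hx => ?_, algebraMap D K d, algebraMap_ne_zero hd, fun x hx => ?_⟩
  · rw [mem_contraction] at hx ⊢
    exact ⟨hL.1 a (hAT ha) x hx.1, fun T' hT' hle hne =>
      T'.mul_mem (hle ha) (hx.2 T' hT' hle hne)⟩
  · rw [mem_contraction] at hx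
    refine mem_of_mem_skeleton hA fun T' hT' hle => ?_
    rcases eq_or_ne T' T with rfl | hne
    · exact hdL x hx.1
    · exact T'.mul_mem (T'.algebraMap_mem d) (hx.2 T' hT' hle hne)

theorem IsIndependentDecomp.contraction_mul (h : IsIndependentDecomp D K) {A T : Subalgebra D K}
    (hT : T ∈ stdDecomp D K) {L : Submodule D K} (hL : IsFracOf D K T L) :
    contraction A T L * Subalgebra.toSubmodule T = L := by
  refine le_antisymm (mul_toSubmodule_le inf_le_left hL.1) fun y hy => ?_
  obtain ⟨a, b, hb, rfl⟩ := exists_eq_div (D := D) y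
  obtain ⟨s, hs, hsT, hs'⟩ := h.exists_inv_mem T hT b hb
  have hmem : algebraMap D K s * (algebraMap D K a / algebraMap D K b) ∈ contraction A T L := by
    refine mem_contraction.2 ⟨hL.1 _ (T.algebraMap_mem s) _ hy, fun T' hT' _ hne => ?_⟩
    convert T'.mul_mem (T'.algebraMap_mem a) (hs' T' hT' hne) using 1
    ring
  have := mul_toSubmodule_mem hsT (le_mul_toSubmodule _ T hmem)
  rwa [inv_mul_cancel_left₀ (algebraMap_ne_zero hs)] at this

namespace Semistar

/-- The fractional star operation `I * T ↦ I^⋆ * T` on a member `T` of the standard decomposition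
induced by a semistar operation with `A ≤ T` in its support. -/
def localize (s : Semistar D K) (h : IsIndependentDecomp D K) {A T : Subalgebra D K}
    (hT : T ∈ stdDecomp D K) (hA : A ∈ supp D K s) (hAT : A ≤ T) : FracStar D K T where
  toFun L := ⟨s.toFun (contraction A T L.1) * Subalgebra.toSubmodule T,
    h.isFracOf_mul hT ((s.isFracOf hA.2 (contraction_isFracOf hA.1 hAT L.2)).mul_ne_top
      (h.ne_top T hT) hAT)⟩
  le_star' L :=
    (h.contraction_mul (A := A) hT L.2).ge.trans (mul_le_mul_left (s.le_star' _) _)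
  mono' L L' hL := mul_le_mul_left (s.mono' (contraction_mono le_rfl hL)) _
  idem' L := by
    have hI := contraction_isFracOf hA.1 hAT L.2
    have hfr := h.isFracOf_mul hT ((s.isFracOf hA.2 hI).mul_ne_top (h.ne_top T hT) hAT)
    apply Subtype.ext
    refine le_antisymm (mul_toSubmodule_le ?_ hfr.1) ?_
    · exact (h.star_le_star_mul s hT (contraction_isFracOf hA.1 hAT hfr) (s.isFracOf hA.2 hI)
        inf_le_left).trans (by rw [s.idem'])
    · exact (h.contraction_mul (A := A) hT hfr).ge.trans (mul_le_mul_left (s.le_star' _) _)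
  smul' c hc L L' hL := by
    have hI := contraction_isFracOf hA.1 hAT L.2
    have hI' := contraction_isFracOf hA.1 hAT L'.2
    rw [← mul_assoc, ← s.smul' c hc]
    refine le_antisymm (mul_toSubmodule_le (h.star_le_star_mul s hT hI' (hI.span_mul hc) ?_)
      fun t ht x hx => mul_toSubmodule_mem ht hx)
      (mul_toSubmodule_le (h.star_le_star_mul s hT (hI.span_mul hc) hI' ?_)
      fun t ht x hx => mul_toSubmodule_mem ht hx)
    · rw [mul_assoc, h.contraction_mul hT L.2, ← hL]
      exact inf_le_left
    · rw [h.contraction_mul hT L'.2, hL]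
      exact mul_le_mul_right inf_le_left _

theorem localize_apply (s : Semistar D K) (h : IsIndependentDecomp D K) {A T : Subalgebra D K}
    (hT : T ∈ stdDecomp D K) (hA : A ∈ supp D K s) (hAT : A ≤ T) {I : Submodule D K}
    (hI : IsFracOf D K A I) (L : {L : Submodule D K // IsFracOf D K T L})
    (hL : L.1 = I * Subalgebra.toSubmodule T) :
    ((s.localize h hT hA hAT).toFun L).1 = s.toFun I * Subalgebra.toSubmodule T := by
  have hI' := contraction_isFracOf hA.1 hAT L.2
  refine le_antisymm (mul_toSubmodule_le (h.star_le_star_mul s hT hI' hI ?_)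
      fun t ht x hx => mul_toSubmodule_mem ht hx)
      (mul_toSubmodule_le (h.star_le_star_mul s hT hI hI' ?_)
      fun t ht x hx => mul_toSubmodule_mem ht hx)
  · rw [← hL]
    exact inf_le_left
  · rw [h.contraction_mul hT L.2, hL]
    exact le_mul_toSubmodule I T

theorem localize_mono {s s' : Semistar D K} (h : IsIndependentDecomp D K)
    {A B T : Subalgebra D K} (hT : T ∈ stdDecomp D K) (hA : A ∈ supp D K s) (hAT : A ≤ T)
    (hB : B ∈ supp D K s') (hBT : B ≤ T) (hs : s ≤ s') (hAB : A ≤ B) :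
    s.localize h hT hA hAT ≤ s'.localize h hT hB hBT := fun _ =>
  mul_le_mul_left ((hs _).trans (s'.mono' (contraction_mono hAB le_rfl))) _

end Semistar

end Localization

section Gluing

variable (D : Type*) [CommRing D] [IsDomain D]
variable (K : Type*) [Field K] [Algebra D K] [IsFractionRing D K]

/-- A subset of the skeleton, different from `{K}`, containing `K` and closed under
intersections. -/
structure IsSupportSet (Δ : Set (Subalgebra D K)) : Prop where
  indep : IsIndependentDecomp D K
  subset : Δ ⊆ SkOver D K
  top_mem : ⊤ ∈ Δ
  inf_mem : ∀ A ∈ Δ, ∀ B ∈ Δ, A ⊓ B ∈ Δ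
  exists_ne_top : ∃ A ∈ Δ, A ≠ ⊤

/-- The families of order-preserving maps from `Δ(T)` to the fractional star operations on `T`. -/
abbrev LocalStars (Δ : Set (Subalgebra D K)) : Type _ :=
  ∀ T : {T : Subalgebra D K // T ∈ stdDecomp D K ∧ ∃ A ∈ Δ, A ≤ T},
    ({A : Subalgebra D K // A ∈ Δ ∧ A ≤ T.1} →o FracStar D K T.1)

variable {D K}

/-- The elements `A` of `Δ` such that `I * A` is a fractional ideal of `A`. -/
def fracRings (Δ : Set (Subalgebra D K)) (I : Submodule D K) : Set (Subalgebra D K) :=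
  {A | A ∈ Δ ∧ ∀ T ∈ stdDecomp D K, A ≤ T → I * Subalgebra.toSubmodule T ≠ ⊤}

/-- The smallest element `A` of `Δ` such that `I * A` is a fractional ideal of `A`. -/
def fracRing (Δ : Set (Subalgebra D K)) (I : Submodule D K) : Subalgebra D K :=
  sInf (fracRings Δ I)

/-- The closure of `I` obtained by intersecting its local closures. -/
def glueFun {Δ : Set (Subalgebra D K)} (Φ : LocalStars D K Δ) (I : Submodule D K) :
    Submodule D K :=
  ⨅ (T : {T : Subalgebra D K // T ∈ stdDecomp D K ∧ ∃ A ∈ Δ, A ≤ T})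
    (hA : fracRing Δ I ∈ Δ ∧ fracRing Δ I ≤ T.1)
    (hL : IsFracOf D K T.1 (I * Subalgebra.toSubmodule T.1)),
    ((Φ T ⟨fracRing Δ I, hA⟩).toFun ⟨I * Subalgebra.toSubmodule T.1, hL⟩).1

theorem mem_glueFun {Δ : Set (Subalgebra D K)} {Φ : LocalStars D K Δ} {I : Submodule D K}
    {x : K} : x ∈ glueFun Φ I ↔
      ∀ (T : {T : Subalgebra D K // T ∈ stdDecomp D K ∧ ∃ A ∈ Δ, A ≤ T})
        (hA : fracRing Δ I ∈ Δ ∧ fracRing Δ I ≤ T.1)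
        (hL : IsFracOf D K T.1 (I * Subalgebra.toSubmodule T.1)),
        x ∈ ((Φ T ⟨fracRing Δ I, hA⟩).toFun ⟨I * Subalgebra.toSubmodule T.1, hL⟩).1 := by
  simp only [glueFun, Submodule.mem_iInf]

theorem LocalStars.mul_mem {Δ : Set (Subalgebra D K)} (Φ : LocalStars D K Δ)
    (T : {T : Subalgebra D K // T ∈ stdDecomp D K ∧ ∃ A ∈ Δ, A ≤ T})
    {A B : {A : Subalgebra D K // A ∈ Δ ∧ A ≤ T.1}} (hAB : A ≤ B) {c : K} (hc : c ≠ 0)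
    {L L' : {I : Submodule D K // IsFracOf D K T.1 I}} (h : ∀ z ∈ L.1, c * z ∈ L'.1) {x : K}
    (hx : x ∈ ((Φ T A).toFun L).1) : c * x ∈ ((Φ T B).toFun L').1 :=
  (Φ T B).mul_mem hc L.2 L'.2 h ((Φ T).mono hAB L hx)

theorem LocalStars.mono {Δ : Set (Subalgebra D K)} (Φ : LocalStars D K Δ)
    (T : {T : Subalgebra D K // T ∈ stdDecomp D K ∧ ∃ A ∈ Δ, A ≤ T})
    {A B : {A : Subalgebra D K // A ∈ Δ ∧ A ≤ T.1}} (hAB : A ≤ B)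
    {L L' : {I : Submodule D K // IsFracOf D K T.1 I}} (h : L.1 ≤ L'.1) :
    ((Φ T A).toFun L).1 ≤ ((Φ T B).toFun L').1 :=
  ((Φ T).mono hAB L).trans ((Φ T B).mono' _ _ h)

namespace IsSupportSet

variable {Δ : Set (Subalgebra D K)} (h : IsSupportSet D K Δ)
include h

theorem top_mem_fracRings (I : Submodule D K) : ⊤ ∈ fracRings Δ I :=
  ⟨h.top_mem, fun T hT hle => (h.indep.ne_top T hT (top_le_iff.1 hle)).elim⟩

theorem inf_mem_fracRings {I : Submodule D K} {A B : Subalgebra D K} (hA : A ∈ fracRings Δ I)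
    (hB : B ∈ fracRings Δ I) : A ⊓ B ∈ fracRings Δ I :=
  ⟨h.inf_mem A hA.1 B hB.1, fun T hT hle =>
    (h.indep.le_or_le_of_inf_le (h.subset hA.1) (h.subset hB.1) hT hle).elim
      (hA.2 T hT) (hB.2 T hT)⟩

theorem fracRing_mem_fracRings (I : Submodule D K) : fracRing Δ I ∈ fracRings Δ I := by
  have hfin : (fracRings Δ I).Finite := by
    refine (h.indep.finite.powerset.image sInf).subset fun A hA => ?_
    obtain ⟨S, hS, rfl⟩ := h.subset hA.1
    exact ⟨S, hS, rfl⟩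
  obtain ⟨m, hm, hmin⟩ := hfin.exists_minimal ⟨⊤, h.top_mem_fracRings I⟩
  have hleast : IsLeast (fracRings Δ I) m :=
    ⟨hm, fun A hA => (hmin (h.inf_mem_fracRings hm hA) inf_le_left).trans inf_le_right⟩
  rw [fracRing, hleast.isGLB.sInf_eq]
  exact hm

theorem fracRing_mem (I : Submodule D K) : fracRing Δ I ∈ Δ := (h.fracRing_mem_fracRings I).1

theorem mul_ne_top {I : Submodule D K} {T : Subalgebra D K} (hT : T ∈ stdDecomp D K)
    (hle : fracRing Δ I ≤ T) : I * Subalgebra.toSubmodule T ≠ ⊤ :=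
  (h.fracRing_mem_fracRings I).2 T hT hle

theorem isFracOf_mul {I : Submodule D K} {T : Subalgebra D K} (hT : T ∈ stdDecomp D K)
    (hle : fracRing Δ I ≤ T) : IsFracOf D K T (I * Subalgebra.toSubmodule T) :=
  h.indep.isFracOf_mul hT (h.mul_ne_top hT hle)

theorem fracRing_le_fracRing {c : K} (hc : c ≠ 0) {I J : Submodule D K}
    (hIJ : ∀ z ∈ I, c * z ∈ J) : fracRing Δ I ≤ fracRing Δ J := by
  refine sInf_le ⟨h.fracRing_mem J, fun T hT hle htop => h.mul_ne_top hT hle ?_⟩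
  refine eq_top_iff.2 fun x _ => ?_
  have hx : c⁻¹ * x ∈ I * Subalgebra.toSubmodule T := htop ▸ Submodule.mem_top
  simpa [hc] using mul_mem_mul_toSubmodule hIJ hx

theorem fracRing_eq {A : Subalgebra D K} (hA : A ∈ Δ) {I : Submodule D K} (hI0 : I ≠ ⊥)
    (hI : IsFracOf D K A I) : fracRing Δ I = A := by
  refine le_antisymm
    (sInf_le ⟨hA, fun T hT hle => hI.mul_ne_top (h.indep.ne_top T hT) hle⟩)
    (skeleton_le (h.subset (h.fracRing_mem I)) fun T hT hle => ?_)
  exact h.indep.le_of_mul_ne_top (h.subset hA) hT hI.1 hI0 (h.mul_ne_top hT hle)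

theorem exists_fracRing_bot_le : ∃ T ∈ stdDecomp D K, fracRing Δ ⊥ ≤ T := by
  obtain ⟨A, hA, hne⟩ := h.exists_ne_top
  obtain ⟨T, hT, hle⟩ := exists_le_of_skeleton_ne_top (h.subset hA) hne
  refine ⟨T, hT, le_trans (sInf_le ⟨hA, fun T hT hle => ?_⟩) hle⟩
  exact (IsFracOf.bot A).mul_ne_top (h.indep.ne_top T hT) hle

theorem glueFun_mul_mem (Φ : LocalStars D K Δ) {c : K} (hc : c ≠ 0) {I J : Submodule D K}
    (hIJ : ∀ z ∈ I, c * z ∈ J) {x : K} (hx : x ∈ glueFun Φ I) : c * x ∈ glueFun Φ J := by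
  refine mem_glueFun.2 fun T hA hL => ?_
  have hle := h.fracRing_le_fracRing hc hIJ
  have hI : fracRing Δ I ∈ Δ ∧ fracRing Δ I ≤ T.1 := ⟨h.fracRing_mem I, hle.trans hA.2⟩
  exact Φ.mul_mem T (A := ⟨_, hI⟩) (B := ⟨_, hA⟩) hle hc
    (fun z hz => mul_mem_mul_toSubmodule hIJ hz)
    (mem_glueFun.1 hx T hI (h.isFracOf_mul T.2.1 hI.2))

theorem glueFun_mono (Φ : LocalStars D K Δ) {I J : Submodule D K} (hIJ : I ≤ J) :
    glueFun Φ I ≤ glueFun Φ J := fun x hx => by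
  simpa using h.glueFun_mul_mem Φ one_ne_zero (J := J) (fun z hz => by simpa using hIJ hz) hx

omit h in
theorem le_glueFun (Φ : LocalStars D K Δ) (I : Submodule D K) : I ≤ glueFun Φ I := fun _ hx =>
  mem_glueFun.2 fun T hA hL => (Φ T ⟨_, hA⟩).le_star' ⟨_, hL⟩ (le_mul_toSubmodule I T.1 hx)

omit h in
theorem glueFun_mul_le (Φ : LocalStars D K Δ) (I : Submodule D K)
    (T : {T : Subalgebra D K // T ∈ stdDecomp D K ∧ ∃ A ∈ Δ, A ≤ T})
    (hA : fracRing Δ I ∈ Δ ∧ fracRing Δ I ≤ T.1)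
    (hL : IsFracOf D K T.1 (I * Subalgebra.toSubmodule T.1)) :
    glueFun Φ I * Subalgebra.toSubmodule T.1 ≤ ((Φ T ⟨_, hA⟩).toFun ⟨_, hL⟩).1 :=
  mul_toSubmodule_le (fun _ hy => mem_glueFun.1 hy T hA hL) ((Φ T ⟨_, hA⟩).toFun ⟨_, hL⟩).2.1

theorem glueFun_mul_ne_top (Φ : LocalStars D K Δ) {I : Submodule D K} {T : Subalgebra D K}
    (hT : T ∈ stdDecomp D K) (hle : fracRing Δ I ≤ T) :
    glueFun Φ I * Subalgebra.toSubmodule T ≠ ⊤ := by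
  intro htop
  have hm := glueFun_mul_le Φ I ⟨T, hT, _, h.fracRing_mem I, hle⟩ ⟨h.fracRing_mem I, hle⟩
    (h.isFracOf_mul hT hle)
  obtain ⟨-, d, hd, hdT⟩ := ((Φ ⟨T, hT, _, h.fracRing_mem I, hle⟩
    ⟨_, h.fracRing_mem I, hle⟩).toFun ⟨_, h.isFracOf_mul hT hle⟩).2
  exact h.indep.ne_top T hT (eq_top_of_forall_mul_mem hd fun x =>
    hdT x (hm (htop ▸ Submodule.mem_top)))

theorem glueFun_idem (Φ : LocalStars D K Δ) (I : Submodule D K) :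
    glueFun Φ (glueFun Φ I) = glueFun Φ I := by
  refine le_antisymm (fun x hx => mem_glueFun.2 fun T hA hL => ?_) (le_glueFun Φ _)
  have hle : fracRing Δ (glueFun Φ I) ≤ fracRing Δ I :=
    sInf_le ⟨h.fracRing_mem I, fun T hT hle => h.glueFun_mul_ne_top Φ hT hle⟩
  have hA' : fracRing Δ (glueFun Φ I) ∈ Δ ∧ fracRing Δ (glueFun Φ I) ≤ T.1 :=
    ⟨h.fracRing_mem _, hle.trans hA.2⟩
  have := Φ.mono T (A := ⟨_, hA'⟩) (B := ⟨_, hA⟩) hle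
    (L := ⟨_, h.isFracOf_mul T.2.1 hA'.2⟩) (glueFun_mul_le Φ I T hA hL)
    (mem_glueFun.1 hx T hA' (h.isFracOf_mul T.2.1 hA'.2))
  rwa [FracStar.idem'] at this

/-- The semistar operation glued from a compatible family of fractional star operations on the
members of the standard decomposition. -/
def glue (Φ : LocalStars D K Δ) : Semistar D K where
  toFun := glueFun Φ
  le_star' := le_glueFun Φ
  mono' _ _ := h.glueFun_mono Φ
  idem' := h.glueFun_idem Φ
  smul' c hc I := by
    refine le_antisymm (fun x hx => ?_) fun x hx => ?_
    · refine Submodule.mem_span_singleton_mul.2 ⟨c⁻¹ * x, ?_, mul_inv_cancel_left₀ hc x⟩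
      refine h.glueFun_mul_mem Φ (inv_ne_zero hc) (fun z hz => ?_) hx
      obtain ⟨y, hy, rfl⟩ := Submodule.mem_span_singleton_mul.1 hz
      rwa [inv_mul_cancel_left₀ hc]
    · obtain ⟨y, hy, rfl⟩ := Submodule.mem_span_singleton_mul.1 hx
      exact h.glueFun_mul_mem Φ hc
        (fun z hz => Submodule.mem_span_singleton_mul.2 ⟨z, hz, rfl⟩) hy

theorem glueFun_bot (Φ : LocalStars D K Δ) : glueFun Φ ⊥ = ⊥ := by
  obtain ⟨T, hT, hle⟩ := h.exists_fracRing_bot_le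
  refine le_bot_iff.1 fun x hx => ?_
  have := mem_glueFun.1 hx ⟨T, hT, _, h.fracRing_mem ⊥, hle⟩ ⟨h.fracRing_mem ⊥, hle⟩
    (h.isFracOf_mul hT hle)
  simp only [Submodule.bot_mul] at this
  rwa [FracStar.toFun_bot (h.indep.ne_top T hT)] at this

theorem glueFun_mul (Φ : LocalStars D K Δ)
    (T : {T : Subalgebra D K // T ∈ stdDecomp D K ∧ ∃ A ∈ Δ, A ≤ T})
    (A : {A : Subalgebra D K // A ∈ Δ ∧ A ≤ T.1}) {I : Submodule D K} (hI : IsFracOf D K A.1 I)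
    (hL : IsFracOf D K T.1 (I * Subalgebra.toSubmodule T.1)) :
    glueFun Φ I * Subalgebra.toSubmodule T.1 = ((Φ T A).toFun ⟨_, hL⟩).1 := by
  rcases eq_or_ne I ⊥ with rfl | hI0
  · rw [h.glueFun_bot]
    simp only [Submodule.bot_mul]
    rw [FracStar.toFun_bot (h.indep.ne_top T.1 T.2.1)]
  have hB := h.fracRing_eq A.2.1 hI0 hI
  have hA : fracRing Δ I ∈ Δ ∧ fracRing Δ I ≤ T.1 := hB ▸ A.2
  have hAB : (⟨fracRing Δ I, hA⟩ : {A : Subalgebra D K // A ∈ Δ ∧ A ≤ T.1}) = A :=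
    Subtype.ext hB
  refine le_antisymm (mul_toSubmodule_le (fun y hy => hAB ▸ mem_glueFun.1 hy T hA hL)
    ((Φ T A).toFun ⟨_, hL⟩).2.1) fun y hy => ?_
  obtain ⟨x, hx, hx0⟩ := Submodule.exists_mem_ne_zero_of_ne_bot hI0
  obtain ⟨a, b, hb, hab⟩ := exists_eq_div (D := D) (y / x)
  have hb' := algebraMap_ne_zero (K := K) hb
  rw [div_eq_div_iff hx0 hb'] at hab
  obtain ⟨s, hs, hsT, hs'⟩ := h.indep.exists_inv_mem T.1 T.2.1 b hb
  have hmem : algebraMap D K s * y ∈ glueFun Φ I := by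
    refine mem_glueFun.2 fun T' hA' hL' => ?_
    have hmod := ((Φ T' ⟨_, hA'⟩).toFun ⟨_, hL'⟩).2.1
    by_cases hT : T' = T
    · subst hT
      exact hmod _ (T'.1.algebraMap_mem s) _ (hAB.symm ▸ hy)
    · have hxT := (Φ T' ⟨_, hA'⟩).le_star' ⟨_, hL'⟩ (le_mul_toSubmodule I T'.1 hx)
      have hsa := T'.1.mul_mem (hs' T'.1 T'.2.1 fun he => hT (Subtype.ext he))
        (T'.1.algebraMap_mem a)
      convert hmod _ hsa _ hxT using 1
      field_simp
      rw [mul_assoc, hab]; ring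
  have := mul_toSubmodule_mem hsT (le_mul_toSubmodule _ T.1 hmem)
  rwa [inv_mul_cancel_left₀ (algebraMap_ne_zero hs)] at this

theorem supp_glue (Φ : LocalStars D K Δ) : supp D K (h.glue Φ) = Δ := by
  have hA0 : ∀ A : Subalgebra D K, Subalgebra.toSubmodule A ≠ ⊥ := fun A hA =>
    one_ne_zero (α := K) (Submodule.mem_bot D |>.1 (hA ▸ A.one_mem))
  ext A
  constructor
  · rintro ⟨hA, hfr⟩
    have hB := h.fracRing_mem (Subalgebra.toSubmodule A)
    suffices fracRing Δ (Subalgebra.toSubmodule A) = A from this ▸ hB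
    refine le_antisymm (skeleton_le hA fun T hT hAT => ?_)
      (skeleton_le (h.subset hB) fun T hT hle => ?_)
    · by_contra hle
      refine hfr.mul_ne_top (h.indep.ne_top T hT) hAT
        (h.indep.mul_eq_top (h.subset hB) hT hle one_ne_zero fun b hb => ?_)
      refine mem_glueFun.2 fun T' hA' hL' => ?_
      exact ((Φ T' ⟨_, hA'⟩).toFun ⟨_, hL'⟩).2.1 b (hA'.2 hb) 1
        ((Φ T' ⟨_, hA'⟩).le_star' ⟨_, hL'⟩ (le_mul_toSubmodule _ _ A.one_mem))
    · exact h.indep.le_of_mul_ne_top hA hT (fun a ha x hx => A.mul_mem ha hx) (hA0 A)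
        (h.mul_ne_top hT hle)
  · intro hA
    have hB := h.fracRing_eq hA (hA0 A) (IsFracOf.toSubmodule A)
    exact ⟨h.subset hA, fun a ha x hx => (h.glue Φ).mul_mem (fun z hz => A.mul_mem ha hz) hx,
      h.indep.exists_denominator_skeleton (h.subset hA) fun T hT hAT =>
        h.glueFun_mul_ne_top Φ hT (hB.trans_le hAT)⟩

theorem glueFun_eq (s : Semistar D K) (hs : supp D K s = Δ) (Φ : LocalStars D K Δ)
    (hΦ : ∀ (T : {T : Subalgebra D K // T ∈ stdDecomp D K ∧ ∃ A ∈ Δ, A ≤ T})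
      (A : {A : Subalgebra D K // A ∈ Δ ∧ A ≤ T.1}) (I : Submodule D K), IsFracOf D K A.1 I →
      ∀ L : {L : Submodule D K // IsFracOf D K T.1 L}, L.1 = I * Subalgebra.toSubmodule T.1 →
        ((Φ T A).toFun L).1 = s.toFun I * Subalgebra.toSubmodule T.1) (I : Submodule D K) :
    glueFun Φ I = s.toFun I := by
  rcases eq_or_ne I ⊥ with rfl | hI0
  · obtain ⟨A, hA, hne⟩ := h.exists_ne_top
    rw [h.glueFun_bot, s.toFun_bot hne (hs.ge hA)]
  obtain ⟨x, hx, hx0⟩ := Submodule.exists_mem_ne_zero_of_ne_bot hI0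
  have hxs := s.le_star' I hx
  set B := fracRing Δ I with hBdef
  have hB : B ∈ supp D K s := hs.ge (h.fracRing_mem I)
  have hBI : IsFracOf D K B (I * Subalgebra.toSubmodule B) := by
    refine ⟨fun b hb y hy => mul_toSubmodule_mem hb hy,
      h.indep.exists_denominator_skeleton hB.1 fun T hT hBT => ?_⟩
    rw [mul_toSubmodule_mul_toSubmodule I hBT]
    exact h.mul_ne_top hT hBT
  have hmem : ∀ w ∈ B, ∀ y ∈ s.toFun I, w * y ∈ s.toFun I := by
    let S := {T | T ∈ stdDecomp D K ∧ s.toFun I * Subalgebra.toSubmodule T ≠ ⊤}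
    have hS : S ⊆ stdDecomp D K := fun T hT => hT.1
    have hmul : ∀ w ∈ sInf S, ∀ y ∈ s.toFun I, w * y ∈ s.toFun I := by
      intro w hw y hy
      refine h.indep.mem_of_forall _ _ fun T hT => ?_
      by_cases htop : s.toFun I * Subalgebra.toSubmodule T = ⊤
      · rw [htop]; exact Submodule.mem_top
      · exact mul_toSubmodule_mem (Algebra.mem_sInf.1 hw T ⟨hT, htop⟩) (le_mul_toSubmodule _ _ hy)
    obtain ⟨d, hd, hdS⟩ := h.indep.exists_denominator_sInf hS fun T hT => hT.2
    have hsupp : sInf S ∈ supp D K s := by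
      refine ⟨⟨S, hS, rfl⟩, fun a ha y hy => s.mul_mem (fun z hz => (sInf S).mul_mem ha hz) hy,
        d * x, mul_ne_zero hd hx0, fun y hy => ?_⟩
      rw [mul_assoc]
      refine hdS _ ?_
      have := s.mul_mem (c := x) (J := s.toFun I)
        (fun z hz => mul_comm x z ▸ hmul z hz x hxs) hy
      rwa [s.idem'] at this
    have hle : B ≤ sInf S := by
      refine sInf_le ⟨hs.le hsupp, fun T hT hST htop => ?_⟩
      refine mul_toSubmodule_ne_top (h.indep.ne_top T hT) hd (fun y hy => hST (hdS y hy))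
        (top_le_iff.1 (htop.ge.trans (mul_le_mul_left (s.le_star' I) _)))
    exact fun w hw => hmul w (hle hw)
  have hstar : s.toFun (I * Subalgebra.toSubmodule B) = s.toFun I :=
    le_antisymm ((s.mono' (mul_toSubmodule_le (s.le_star' I) hmem)).trans (s.idem' I).le)
      (s.mono' (le_mul_toSubmodule I B))
  have hval : ∀ (T : {T : Subalgebra D K // T ∈ stdDecomp D K ∧ ∃ A ∈ Δ, A ≤ T})
      (hA : B ∈ Δ ∧ B ≤ T.1) (hL : IsFracOf D K T.1 (I * Subalgebra.toSubmodule T.1)),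
      ((Φ T ⟨B, hA⟩).toFun ⟨_, hL⟩).1 = s.toFun I * Subalgebra.toSubmodule T.1 := by
    intro T hA hL
    rw [← hstar]
    exact hΦ T ⟨B, hA⟩ _ hBI ⟨_, hL⟩ (mul_toSubmodule_mul_toSubmodule I hA.2).symm
  refine le_antisymm (fun y hy => h.indep.mem_of_forall _ _ fun T hT => ?_) fun y hy =>
    mem_glueFun.2 fun T hA hL => (hval T hA hL).ge (le_mul_toSubmodule _ _ hy)
  by_cases hBT : B ≤ T
  · let T' : {T : Subalgebra D K // T ∈ stdDecomp D K ∧ ∃ A ∈ Δ, A ≤ T} :=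
      ⟨T, hT, B, h.fracRing_mem I, hBT⟩
    have hA : B ∈ Δ ∧ B ≤ T'.1 := ⟨h.fracRing_mem I, hBT⟩
    exact (hval T' hA (h.isFracOf_mul hT hBT)).le (mem_glueFun.1 hy T' hA _)
  · rw [h.indep.mul_eq_top hB.1 hT hBT hx0 fun b hb => hmem b hb x hxs]
    exact Submodule.mem_top

/-- The family of localizations of a semistar operation with support `Δ`. -/
def localStars (s : {s : Semistar D K // supp D K s = Δ}) : LocalStars D K Δ := fun T =>
  { toFun := fun A => s.1.localize h.indep T.2.1 (s.2.ge A.2.1) A.2.2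
    monotone' := fun A B hAB => Semistar.localize_mono h.indep T.2.1 (s.2.ge A.2.1) A.2.2
      (s.2.ge B.2.1) B.2.2 le_rfl hAB }

theorem localStars_apply (s : {s : Semistar D K // supp D K s = Δ})
    (T : {T : Subalgebra D K // T ∈ stdDecomp D K ∧ ∃ A ∈ Δ, A ≤ T})
    (A : {A : Subalgebra D K // A ∈ Δ ∧ A ≤ T.1}) (I : Submodule D K) (hI : IsFracOf D K A.1 I)
    (L : {L : Submodule D K // IsFracOf D K T.1 L})
    (hL : L.1 = I * Subalgebra.toSubmodule T.1) :
    ((h.localStars s T A).toFun L).1 = s.1.toFun I * Subalgebra.toSubmodule T.1 :=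
  s.1.localize_apply h.indep T.2.1 (s.2.ge A.2.1) A.2.2 hI L hL

theorem glue_localStars (s : {s : Semistar D K // supp D K s = Δ}) :
    h.glue (h.localStars s) = s.1 :=
  Semistar.ext' (funext (h.glueFun_eq s.1 s.2 _ (h.localStars_apply s)))

theorem localStars_glue (Φ : LocalStars D K Δ) :
    h.localStars ⟨h.glue Φ, h.supp_glue Φ⟩ = Φ := by
  funext T
  ext A : 2
  refine FracStar.ext' (funext fun L => Subtype.ext ?_)
  have hA := h.subset A.2.1
  have hL := h.indep.contraction_mul (A := A.1) T.2.1 L.2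
  have hI := contraction_isFracOf hA A.2.2 L.2
  rw [h.localStars_apply _ T A _ hI L hL.symm]
  refine (h.glueFun_mul Φ T A hI (hL.symm ▸ L.2)).trans ?_
  congr 2
  exact Subtype.ext hL

/-- The order isomorphism between the semistar operations with support `Δ` and the families of
order-preserving maps from `Δ(T)` to the fractional star operations on `T`. -/
def orderIso : {s : Semistar D K // supp D K s = Δ} ≃o LocalStars D K Δ where
  toFun := h.localStars
  invFun Φ := ⟨h.glue Φ, h.supp_glue Φ⟩
  left_inv s := Subtype.ext (h.glue_localStars s)
  right_inv := h.localStars_glue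
  map_rel_iff' {s s'} := by
    refine ⟨fun hle => ?_, fun hle T A =>
      Semistar.localize_mono h.indep T.2.1 (s.2.ge A.2.1) A.2.2 (s'.2.ge A.2.1) A.2.2 hle le_rfl⟩
    show s.1 ≤ s'.1
    rw [← h.glue_localStars s, ← h.glue_localStars s']
    exact fun I x hx => mem_glueFun.2 fun T hA hL => hle T _ _ (mem_glueFun.1 hx T hA hL)

end IsSupportSet

end Gluing

/-- For `Δ ≠ {K}` a subset of the skeleton containing `K` and closed
under intersections, the map `Γ_Δ` is an order isomorphism from the semistar
operations with support `Δ` onto `∏ {hom(Δ(T), FStar(T)) : T ∈ Θ, Δ(T) ≠ ∅}`;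
moreover `Γ_Δ(⋆)(T)(A)` is the fractional star operation `I·T ↦ I^⋆·T` on `T`. -/
theorem statement4
    (D : Type*) [CommRing D] [IsDomain D]
    (K : Type*) [Field K] [Algebra D K] [IsFractionRing D K]
    (hPruf : IsPrufer D K) (hsl : IsSemilocal D)
    (Δ : Set (Subalgebra D K)) (hΔ : Δ ⊆ SkOver D K)
    (hK : (⊤ : Subalgebra D K) ∈ Δ) (hne : Δ ≠ {⊤})
    (hint : ∀ A ∈ Δ, ∀ B ∈ Δ, A ⊓ B ∈ Δ) :
    ∃ e : {s : Semistar D K // supp D K s = Δ} ≃o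
        (∀ T : {T : Subalgebra D K // T ∈ stdDecomp D K ∧ ∃ A ∈ Δ, A ≤ T},
          ({A : Subalgebra D K // A ∈ Δ ∧ A ≤ T.1} →o FracStar D K T.1)),
      ∀ (s : {s : Semistar D K // supp D K s = Δ})
        (T : {T : Subalgebra D K // T ∈ stdDecomp D K ∧ ∃ A ∈ Δ, A ≤ T})
        (A : {A : Subalgebra D K // A ∈ Δ ∧ A ≤ T.1})
        (I : Submodule D K), IsFracOf D K A.1 I →
        ∀ L : {L : Submodule D K // IsFracOf D K T.1 L},
          L.1 = I * Subalgebra.toSubmodule T.1 →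
          ((e s T A).toFun L).1 = s.1.toFun I * Subalgebra.toSubmodule T.1 := by
  obtain ⟨A₀, hA₀, hA₀'⟩ : ∃ A ∈ Δ, A ≠ ⊤ := by
    by_contra! hcon
    exact hne (Set.eq_singleton_iff_unique_mem.2 ⟨hK, hcon⟩)
  have h : IsSupportSet D K Δ :=
    ⟨isIndependentDecomp hPruf hsl fun _ hM => ne_bot_of_skeleton_ne_top (hΔ hA₀) hA₀' hM, hΔ, hK,
      hint, A₀, hA₀, hA₀'⟩
  exact ⟨h.orderIso, h.localStars_apply⟩

end Paper
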